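/- Let d ≥ 1 be an integer and R > 0. Then there exists a smooth compactly supported map φ : ℝ^d → ℝ^d such that φ(s) = s whenever |s| < R, φ(s) = 0 whenever |s| ≥ eR (where e is Euler's number), and the operator norm of the derivative of φ satisfies ‖Dφ(s)‖ ≤ 1 for every s ∈ ℝ^d. -/

import Mathlib

open Real

section Radial

variable {E : Type*} [NormedAddCommGroup E] [InnerProductSpace ℝ E]

/-- The radial map with profile `h`, sending `s` to `h ‖s‖ • s / ‖s‖`. -/
noncomputable def radialMap (h : ℝ → ℝ) (s : E) : E := (h ‖s‖ / ‖s‖) • s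

lemma lipschitzWith_radialMap {h : ℝ → ℝ} (h_nonneg : ∀ r, 0 ≤ h r)
    (h_le : ∀ r, 0 ≤ r → h r ≤ r) (h_lip : LipschitzWith 1 h) :
    LipschitzWith 1 (radialMap h : E → E) := by
  have norm_sq_smul_sub (k l : ℝ) (s t : E) : ‖k • s - l • t‖ ^ 2 =
      (k * ‖s‖ - l * ‖t‖) ^ 2 + 2 * (k * l) * (‖s‖ * ‖t‖ - inner ℝ s t) := by
    rw [norm_sub_sq_real, norm_smul, norm_smul, real_inner_smul_left, real_inner_smul_right,
      mul_pow, mul_pow, norm_eq_abs, norm_eq_abs, sq_abs, sq_abs]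
    ring
  have h_mul (s : E) : h ‖s‖ / ‖s‖ * ‖s‖ = h ‖s‖ := by
    rcases eq_or_ne ‖s‖ 0 with hs | hs
    · have := h_le 0 le_rfl
      have := h_nonneg 0
      rw [hs, mul_zero]
      linarith
    · exact div_mul_cancel₀ _ hs
  have ratio_nonneg (s : E) : 0 ≤ h ‖s‖ / ‖s‖ := div_nonneg (h_nonneg _) (norm_nonneg _)
  have ratio_le (s : E) : h ‖s‖ / ‖s‖ ≤ 1 :=
    div_le_one_of_le₀ (h_le _ (norm_nonneg _)) (norm_nonneg _)
  refine LipschitzWith.of_dist_le_mul fun s t => ?_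
  rw [NNReal.coe_one, one_mul, dist_eq_norm, dist_eq_norm]
  refine (sq_le_sq₀ (norm_nonneg _) (norm_nonneg _)).1 ?_
  have key := norm_sq_smul_sub 1 1 s t
  simp only [one_smul, one_mul, mul_one] at key
  rw [radialMap, radialMap, norm_sq_smul_sub, key, h_mul, h_mul]
  have profile_le : (h ‖s‖ - h ‖t‖) ^ 2 ≤ (‖s‖ - ‖t‖) ^ 2 := by
    refine sq_le_sq.2 ?_
    simpa [Real.dist_eq] using h_lip.dist_le_mul ‖s‖ ‖t‖
  have angle_nonneg : 0 ≤ ‖s‖ * ‖t‖ - inner ℝ s t := sub_nonneg.2 (real_inner_le_norm s t)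
  have ratio_mul_le : h ‖s‖ / ‖s‖ * (h ‖t‖ / ‖t‖) ≤ 1 :=
    mul_le_one₀ (ratio_le s) (ratio_nonneg t) (ratio_le t)
  nlinarith

end Radial

section Mollification

open MeasureTheory Convolution

variable {E : Type*} [NormedAddCommGroup E] [InnerProductSpace ℝ E] [FiniteDimensional ℝ E]
  [MeasurableSpace E] [BorelSpace E] (b : ContDiffBump (0 : E))

/-- The mollification of a vector field by a normalized bump function. -/
noncomputable def mollify (g : E → E) (x : E) : E :=
  ∫ t, b.normed volume t • g (x - t)

lemma integrable_normed_smul {f : E → E} (hf : Continuous f) :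
    Integrable fun t => b.normed volume t • f t :=
  (b.continuous_normed.smul hf).integrable_of_hasCompactSupport
    (b.hasCompactSupport_normed.smul_right)

lemma contDiff_mollify {g : E → E} (hg : Continuous g) :
    ContDiff ℝ (⊤ : ℕ∞) (mollify b g) :=
  b.hasCompactSupport_normed.contDiff_convolution_left (ContinuousLinearMap.lsmul ℝ ℝ)
    b.contDiff_normed (hg.locallyIntegrable (μ := volume))

lemma lipschitzWith_mollify {g : E → E} (hg : LipschitzWith 1 g) :
    LipschitzWith 1 (mollify b g) := by
  refine LipschitzWith.of_dist_le_mul fun x y => ?_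
  have integrable_shift (z : E) : Integrable fun t => b.normed volume t • g (z - t) :=
    integrable_normed_smul b (hg.continuous.comp (continuous_const.sub continuous_id))
  rw [NNReal.coe_one, one_mul, dist_eq_norm, mollify, mollify,
    ← integral_sub (integrable_shift x) (integrable_shift y)]
  calc _ ≤ ∫ t, b.normed volume t * dist x y := by
        refine norm_integral_le_of_norm_le (b.integrable_normed.mul_const _) (.of_forall fun t => ?_)
        rw [← smul_sub, norm_smul, Real.norm_of_nonneg (b.nonneg_normed t), ← dist_eq_norm]
        refine mul_le_mul_of_nonneg_left ?_ (b.nonneg_normed t)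
        simpa using hg.dist_le_mul (x - t) (y - t)
    _ = dist x y := by rw [integral_mul_const, b.integral_normed, one_mul]

lemma mollify_congr {g g' : E → E} {x : E} (h : ∀ t, ‖t‖ < b.rOut → g (x - t) = g' (x - t)) :
    mollify b g x = mollify b g' x := by
  refine integral_congr_ae (.of_forall fun t => ?_)
  by_cases ht : ‖t‖ < b.rOut
  · simp only [h t ht]
  · have : t ∉ Function.support (b.normed volume) := by
      rwa [b.support_normed_eq, mem_ball_zero_iff]
    simp only [Function.notMem_support.1 this, zero_smul]

lemma mollify_id (x : E) : mollify b id x = x := by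
  have moment_zero : ∫ t, b.normed volume t • t = 0 := by
    have h := integral_neg_eq_self (fun t : E => b.normed volume t • t) volume
    simp only [b.normed_neg, smul_neg, integral_neg] at h
    have : IsAddTorsionFree E := .of_isTorsionFree ℝ E
    exact self_eq_neg.1 h.symm
  simp only [mollify, id, smul_sub]
  rw [integral_sub (integrable_normed_smul b continuous_const)
    (integrable_normed_smul b continuous_id'), moment_zero, integral_smul_const,
    b.integral_normed, one_smul, sub_zero]

lemma mollify_zero (x : E) : mollify b 0 x = 0 := by
  simp [mollify]

end Mollification

/-- The tent profile of slope one, rising on `[0, a]` and falling on `[a, 2 * a]`. -/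
noncomputable def tentProfile (a r : ℝ) : ℝ := max 0 (min r (2 * a - r))

lemma lipschitzWith_tentProfile (a : ℝ) : LipschitzWith 1 (tentProfile a) := by
  have h : LipschitzWith 1 fun r : ℝ => 2 * a - r := by
    simpa using (LipschitzWith.const (2 * a)).sub (LipschitzWith.id (α := ℝ))
  unfold tentProfile
  simpa using (LipschitzWith.id.min h).const_max 0

/-- Existence of the smooth truncation maps used in the proof that the relaxed
functional can be computed with uniformly bounded sequences. -/
theorem exists_smooth_truncation
    (d : ℕ) (hd : 1 ≤ d) (R : ℝ) (hR : 0 < R) :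
    ∃ φ : EuclideanSpace ℝ (Fin d) → EuclideanSpace ℝ (Fin d),
      ContDiff ℝ (⊤ : ℕ∞) φ ∧ HasCompactSupport φ ∧
      (∀ s : EuclideanSpace ℝ (Fin d), ‖s‖ < R → φ s = s) ∧
      (∀ s : EuclideanSpace ℝ (Fin d), Real.exp 1 * R ≤ ‖s‖ → φ s = 0) ∧
      (∀ s : EuclideanSpace ℝ (Fin d), ‖fderiv ℝ φ s‖ ≤ 1) := by
  let b : ContDiffBump (0 : EuclideanSpace ℝ (Fin d)) :=
    ⟨R / 10, R / 5, by positivity, by linarith⟩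
  let g : EuclideanSpace ℝ (Fin d) → EuclideanSpace ℝ (Fin d) :=
    radialMap (tentProfile (5 / 4 * R))
  have g_lip : LipschitzWith 1 g := lipschitzWith_radialMap (fun r => le_max_left _ _)
    (fun r hr => max_le hr (min_le_left _ _)) (lipschitzWith_tentProfile _)
  have vanish (s : EuclideanSpace ℝ (Fin d)) (hs : Real.exp 1 * R ≤ ‖s‖) :
      mollify b g s = 0 := by
    rw [← mollify_zero b s]
    refine mollify_congr b fun t ht => ?_
    have ht : ‖t‖ < R / 5 := ht
    have h_tri := norm_sub_norm_le s t
    have h_exp : 27 / 10 * R ≤ Real.exp 1 * R :=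
      mul_le_mul_of_nonneg_right (by linarith [Real.exp_one_gt_d9]) hR.le
    have : tentProfile (5 / 4 * R) ‖s - t‖ = 0 :=
      max_eq_left ((min_le_right _ _).trans (by linarith))
    simp [g, radialMap, this]
  refine ⟨mollify b g, contDiff_mollify b g_lip.continuous, ?_, fun s hs => ?_, vanish,
    fun s => ?_⟩
  · refine HasCompactSupport.intro (isCompact_closedBall 0 (Real.exp 1 * R)) fun s hs => ?_
    rw [mem_closedBall_zero_iff, not_le] at hs
    exact vanish s hs.le
  · refine (mollify_congr b fun t ht => ?_).trans (mollify_id b s)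
    have ht : ‖t‖ < R / 5 := ht
    have h_tri := norm_sub_le s t
    have : tentProfile (5 / 4 * R) ‖s - t‖ = ‖s - t‖ := by
      rw [tentProfile, min_eq_left (by linarith), max_eq_right (norm_nonneg _)]
    rcases eq_or_ne (s - t) 0 with h | h
    · simp [g, radialMap, h]
    · simp [g, radialMap, this, div_self (norm_ne_zero_iff.2 h)]
  · simpa using norm_fderiv_le_of_lipschitz ℝ (lipschitzWith_mollify b g_lip)
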